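/- Assume α ∈ ℓ^{1,1}(ℤ) and let λ ∈ ℂ with Im λ ≥ 0 and λ ≠ 0. Then for every x ∈ ℝ the sum Σ_{j∈ℤ, j>x} α_j (e^{2iλ(j−x)} − 1) m_+(λ, j) converges absolutely and m_+ satisfies the fixed-point equation m_+(λ, x) = 1 + (1/(2iλ)) Σ_{j∈ℤ, j>x} α_j (e^{2iλ(j−x)} − 1) m_+(λ, j). Moreover m_+(λ, x) → 1 as x → +∞. -/

import Mathlib

open Complex Filter

/-- The summand of the series defining `m_+(λ,x)`, indexed by an increasing tuple
`j : Fin (n+1) → ℤ` (with the convention `j₀ = x`):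
`∏_{l} α_{j_l} (e^{2iλ(j_l − j_{l−1})} − 1)/(2iλ)`. -/
noncomputable def jostTermP (α : ℤ → ℝ) (lam : ℂ) (x : ℝ) {n : ℕ} (j : Fin (n + 1) → ℤ) : ℂ :=
  ∏ l : Fin (n + 1),
    (α (j l) : ℂ) *
      ((Complex.exp (2 * Complex.I * lam *
          ((j l : ℂ) - (Fin.cons (x : ℂ) (fun k : Fin n => ((j k.castSucc : ℤ) : ℂ)) : Fin (n + 1) → ℂ) l)) - 1) /
        (2 * Complex.I * lam))

/-- The index set for `m_+(λ,x)`: strictly increasing integer tuples above `x`. -/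
def jostIdxP (x : ℝ) (n : ℕ) : Type :=
  {j : Fin (n + 1) → ℤ // StrictMono j ∧ x < ((j 0 : ℤ) : ℝ)}

/-- `m_+(λ, x) = 1 + Σ_{n≥1} Σ_{x<j₁<⋯<j_n} ∏_l α_{j_l} (e^{2iλ(j_l−j_{l−1})}−1)/(2iλ)`. -/
noncomputable def mPlus (α : ℤ → ℝ) (lam : ℂ) (x : ℝ) : ℂ :=
  1 + ∑' (n : ℕ) (j : jostIdxP x n), jostTermP α lam x j.1

/-- The factor `α_j (e^{2iλ(j−x)} − 1)/(2iλ)` contributed by a step from `x` to `j`. -/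
noncomputable def jostStep (α : ℤ → ℝ) (lam : ℂ) (x : ℝ) (j : ℤ) : ℂ :=
  (α j : ℂ) * ((Complex.exp (2 * Complex.I * lam * ((j : ℂ) - (x : ℂ))) - 1) /
    (2 * Complex.I * lam))

lemma jostTermP_zero (α : ℤ → ℝ) (lam : ℂ) (x : ℝ) (j : Fin 1 → ℤ) :
    jostTermP α lam x j = jostStep α lam x (j 0) := by
  simp [jostTermP, jostStep]

lemma jostTermP_succ (α : ℤ → ℝ) (lam : ℂ) (x : ℝ) {n : ℕ} (j : Fin (n + 2) → ℤ) :
    jostTermP α lam x j =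
      jostStep α lam x (j 0) * jostTermP α lam (j 0 : ℝ) (Fin.tail j) := by
  unfold jostTermP
  rw [Fin.prod_univ_succ]
  congr 1
  refine Finset.prod_congr rfl fun l _ => ?_
  refine Fin.cases ?_ (fun k => ?_) l
  · simp [Fin.tail]
  · simp [Fin.tail, ← Fin.succ_castSucc, -Fin.castSucc_succ]

lemma norm_jostStep_le (α : ℤ → ℝ) {lam : ℂ} (him : 0 ≤ lam.im) {x : ℝ} {j : ℤ}
    (hj : x < (j : ℝ)) : ‖jostStep α lam x j‖ ≤ |α j| / ‖lam‖ := by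
  have hexp : ‖Complex.exp (2 * Complex.I * lam * ((j : ℂ) - (x : ℂ)))‖ ≤ 1 := by
    rw [Complex.norm_exp, Real.exp_le_one_iff]
    have : (2 * Complex.I * lam * ((j : ℂ) - (x : ℂ))).re = -(2 * (lam.im * ((j : ℝ) - x))) := by
      simp
      ring
    rw [this]
    have := mul_nonneg him (sub_pos.2 hj).le
    linarith
  have hsub : ‖Complex.exp (2 * Complex.I * lam * ((j : ℂ) - (x : ℂ))) - 1‖ ≤ 2 :=
    (norm_sub_le _ _).trans (by rw [norm_one]; linarith)
  have hden : ‖2 * Complex.I * lam‖ = 2 * ‖lam‖ := by simp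
  unfold jostStep
  rw [norm_mul, norm_div, hden, Complex.norm_real, Real.norm_eq_abs, div_eq_mul_inv |α j|]
  refine mul_le_mul_of_nonneg_left ?_ (abs_nonneg _)
  calc _ ≤ 2 / (2 * ‖lam‖) := div_le_div_of_nonneg_right hsub (by positivity)
    _ = ‖lam‖⁻¹ := by rw [div_mul_eq_div_div, div_self two_ne_zero, one_div]

lemma strictMono_tail {n : ℕ} {j : Fin (n + 2) → ℤ} (hj : StrictMono j) :
    StrictMono (Fin.tail j) :=
  hj.comp Fin.strictMono_succ

lemma norm_jostTermP_le (α : ℤ → ℝ) {lam : ℂ} (him : 0 ≤ lam.im) {n : ℕ} {x : ℝ}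
    {j : Fin (n + 1) → ℤ} (hj : StrictMono j) (hx : x < (j 0 : ℝ)) :
    ‖jostTermP α lam x j‖ ≤ ∏ l, |α (j l)| / ‖lam‖ := by
  induction n generalizing x with
  | zero =>
    rw [jostTermP_zero, Fin.prod_univ_one]
    exact norm_jostStep_le α him hx
  | succ n ih =>
    rw [jostTermP_succ, norm_mul, Fin.prod_univ_succ]
    refine mul_le_mul (norm_jostStep_le α him hx) (ih (strictMono_tail hj) ?_) (norm_nonneg _)
      (by positivity)
    exact Int.cast_lt.2 (hj (Fin.succ_pos 0))

/-- The finset of entries of an increasing tuple of arbitrary length. -/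
def jostIdxFinset (x : ℝ) (p : Σ n, jostIdxP x n) : Finset ℤ :=
  Finset.univ.image p.2.1

lemma jostIdxFinset_injective (x : ℝ) : Function.Injective (jostIdxFinset x) := by
  rintro ⟨n, j, hj, hjx⟩ ⟨m, k, hk, hkx⟩ h
  have h' : Finset.univ.image j = Finset.univ.image k := h
  have hcard := congrArg Finset.card h'
  rw [Finset.card_image_of_injective _ hj.injective,
    Finset.card_image_of_injective _ hk.injective] at hcard
  simp only [Finset.card_univ, Fintype.card_fin, Nat.add_right_cancel_iff] at hcard
  subst hcard
  have hjk : j = k := (StrictMono.range_inj hj hk).1 (by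
    simpa using congrArg (fun s : Finset ℤ => (s : Set ℤ)) h')
  subst hjk
  rfl

lemma norm_jostTermP_le_prod_finset (α : ℤ → ℝ) {lam : ℂ} (him : 0 ≤ lam.im) (x : ℝ)
    (p : Σ n, jostIdxP x n) :
    ‖jostTermP α lam x p.2.1‖ ≤ ∏ i ∈ jostIdxFinset x p, |α i| / ‖lam‖ := by
  unfold jostIdxFinset
  rw [Finset.prod_image p.2.2.1.injective.injOn]
  exact norm_jostTermP_le α him p.2.2.1 p.2.2.2

lemma summable_abs_of_summable_abs_mul {α : ℤ → ℝ}
    (hα : Summable fun j : ℤ => |(j : ℝ)| * |α j|) : Summable fun j => |α j| := by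
  refine Summable.of_norm_bounded_eventually hα ?_
  filter_upwards [(Set.finite_singleton (0 : ℤ)).compl_mem_cofinite] with j hj
  have h1 : (1 : ℝ) ≤ |(j : ℝ)| := by exact_mod_cast Int.one_le_abs hj
  rw [Real.norm_eq_abs, abs_abs]
  exact le_mul_of_one_le_left (abs_nonneg _) h1

section Series

variable {α : ℤ → ℝ} {lam : ℂ}

lemma summable_prod_finset (hα : Summable fun j => |α j|) :
    Summable fun s : Finset ℤ => ∏ i ∈ s, |α i| / ‖lam‖ :=
  summable_finsetProd_of_summable_nonneg (fun _ => by positivity) (hα.div_const _)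

lemma summable_norm_jostTermP (hα : Summable fun j => |α j|) (him : 0 ≤ lam.im) (x : ℝ) :
    Summable fun p : Σ n, jostIdxP x n => ‖jostTermP α lam x p.2.1‖ :=
  .of_nonneg_of_le (fun _ => norm_nonneg _) (norm_jostTermP_le_prod_finset α him x)
    ((summable_prod_finset hα).comp_injective (jostIdxFinset_injective x))

lemma mPlus_eq_tsum_sigma (hα : Summable fun j => |α j|) (him : 0 ≤ lam.im) (x : ℝ) :
    mPlus α lam x = 1 + ∑' p : Σ n, jostIdxP x n, jostTermP α lam x p.2.1 := by
  rw [mPlus, (summable_norm_jostTermP hα him x).of_norm.tsum_sigma]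

lemma norm_mPlus_le (hα : Summable fun j => |α j|) (him : 0 ≤ lam.im) (x : ℝ) :
    ‖mPlus α lam x‖ ≤ 1 + ∑' s : Finset ℤ, ∏ i ∈ s, |α i| / ‖lam‖ := by
  rw [mPlus_eq_tsum_sigma hα him]
  refine (norm_add_le _ _).trans ?_
  rw [norm_one]
  gcongr
  refine (norm_tsum_le_tsum_norm (summable_norm_jostTermP hα him x)).trans ?_
  exact (summable_norm_jostTermP hα him x).tsum_le_tsum_of_inj _ (jostIdxFinset_injective x)
    (fun _ _ => by positivity) (norm_jostTermP_le_prod_finset α him x) (summable_prod_finset hα)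

end Series

/-- Splitting an increasing tuple above `x` into its first entry and an increasing tuple above
that entry, if any. -/
def jostIdxSplit (x : ℝ) : (Σ n, jostIdxP x n) ≃
    {j : ℤ // x < (j : ℝ)} ⊕ Σ j : {j : ℤ // x < (j : ℝ)}, Σ n, jostIdxP (j.1 : ℝ) n where
  toFun
    | ⟨0, t⟩ => .inl ⟨t.1 0, t.2.2⟩
    | ⟨n + 1, t⟩ => .inr ⟨⟨t.1 0, t.2.2⟩, n, Fin.tail t.1, strictMono_tail t.2.1,
        Int.cast_lt.2 (t.2.1 (Fin.succ_pos 0))⟩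
  invFun
    | .inl j => ⟨0, fun _ => j.1, Subsingleton.strictMono (α := Fin 1) _, j.2⟩
    | .inr ⟨j, n, t⟩ => ⟨n + 1, Fin.cons j.1 t.1,
        t.2.1.vecCons (Int.cast_lt.1 t.2.2), j.2⟩
  left_inv := by
    rintro ⟨_ | n, t, ht⟩
    · refine congrArg (Sigma.mk 0) (Subtype.ext (funext fun i => ?_))
      exact congrArg t (Subsingleton.elim (α := Fin 1) _ _)
    · exact congrArg (Sigma.mk (n + 1)) (Subtype.ext (Fin.cons_self_tail t))
  right_inv := by
    rintro (j | ⟨j, n, t, ht⟩) <;> rfl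

section FixedPoint

variable {α : ℤ → ℝ} {lam : ℂ}

lemma jostTermP_jostIdxSplit_symm (x : ℝ) (q) :
    jostTermP α lam x ((jostIdxSplit x).symm q).2.1 =
      Sum.elim (fun j => jostStep α lam x j.1)
        (fun p => jostStep α lam x p.1.1 * jostTermP α lam (p.1.1 : ℝ) p.2.2.1) q := by
  rcases q with j | ⟨j, n, t⟩
  · exact jostTermP_zero α lam x _
  · exact jostTermP_succ α lam x _

lemma hasSum_jostStep_mul_mPlus (hα : Summable fun j => |α j|) (him : 0 ≤ lam.im) (x : ℝ) :
    HasSum (fun j : {j : ℤ // x < (j : ℝ)} => jostStep α lam x j.1 * mPlus α lam (j.1 : ℝ))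
      (mPlus α lam x - 1) := by
  have h : Summable (Sum.elim (fun j : {j : ℤ // x < (j : ℝ)} => jostStep α lam x j.1)
      fun p : Σ j : {j : ℤ // x < (j : ℝ)},
      Σ n, jostIdxP (j.1 : ℝ) n =>
        jostStep α lam x p.1.1 * jostTermP α lam (p.1.1 : ℝ) p.2.2.1) := by
    exact ((jostIdxSplit x).symm.summable_iff.2
      (summable_norm_jostTermP hα him x).of_norm).congr
        (jostTermP_jostIdxSplit_symm x)
  have hl := h.comp_injective Sum.inl_injective
  have hr := h.comp_injective Sum.inr_injective
  simp only [Function.comp_def, Sum.elim_inl, Sum.elim_inr] at hl hr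
  have hm : mPlus α lam x - 1 = ∑' j : {j : ℤ // x < (j : ℝ)}, jostStep α lam x j.1 +
      ∑' p : Σ j : {j : ℤ // x < (j : ℝ)}, Σ n, jostIdxP (j.1 : ℝ) n,
        jostStep α lam x p.1.1 * jostTermP α lam (p.1.1 : ℝ) p.2.2.1 := by
    rw [mPlus_eq_tsum_sigma hα him, add_sub_cancel_left, ← (jostIdxSplit x).symm.tsum_eq,
      tsum_congr (jostTermP_jostIdxSplit_symm x)]
    exact Summable.tsum_sum hl hr
  rw [hm]
  refine (hl.hasSum.add (hr.hasSum.sigma fun j => (hr.sigma_factor j).hasSum)).congr_fun ?_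
  intro j
  rw [mPlus_eq_tsum_sigma hα him, mul_add, mul_one, ← tsum_mul_left]

lemma tendsto_mPlus_atTop (hα : Summable fun j => |α j|) (him : 0 ≤ lam.im) :
    Tendsto (fun x : ℝ => mPlus α lam x) atTop (nhds 1) := by
  have key : Tendsto (fun x : ℝ => ∑' j : ℤ, Set.indicator {j : ℤ | x < (j : ℝ)}
      (fun j => jostStep α lam x j * mPlus α lam (j : ℝ)) j) atTop (nhds (∑' _ : ℤ, 0)) := by
    refine tendsto_tsum_of_dominated_convergence
      ((hα.div_const ‖lam‖).mul_right (1 + ∑' s : Finset ℤ, ∏ i ∈ s, |α i| / ‖lam‖))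
      (fun j => ?_) (.of_forall fun x j => ?_)
    · refine tendsto_const_nhds.congr' ?_
      filter_upwards [eventually_ge_atTop (j : ℝ)] with x hx
      exact (Set.indicator_of_notMem (s := {j : ℤ | x < (j : ℝ)}) hx.not_gt _).symm
    · have hb := norm_mPlus_le hα him (lam := lam) (j : ℝ)
      by_cases hj : x < (j : ℝ)
      · rw [Set.indicator_of_mem (s := {j : ℤ | x < (j : ℝ)}) hj, norm_mul]
        exact mul_le_mul (norm_jostStep_le α him hj) hb (norm_nonneg _) (by positivity)
      · rw [Set.indicator_of_notMem (s := {j : ℤ | x < (j : ℝ)}) hj, norm_zero]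
        exact mul_nonneg (by positivity) ((norm_nonneg _).trans hb)
  rw [tsum_zero] at key
  refine (by simpa using key.const_add 1 : Tendsto _ atTop (nhds (1 : ℂ))).congr fun x => ?_
  have h := (hasSum_jostStep_mul_mPlus hα him x).tsum_eq
  rw [← tsum_subtype, show ∑' j : {j : ℤ | x < (j : ℝ)}, _ = _ from h, add_sub_cancel]

end FixedPoint

/-- For `α ∈ ℓ^{1,1}(ℤ)`, `Im λ ≥ 0`, `λ ≠ 0`: for every `x` the series
`Σ_{j>x} α_j (e^{2iλ(j−x)} − 1) m_+(λ,j)` converges absolutely, `m_+` satisfies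
the fixed point equation
`m_+(λ,x) = 1 + (2iλ)⁻¹ Σ_{j>x} α_j (e^{2iλ(j−x)} − 1) m_+(λ,j)`, and
`m_+(λ,x) → 1` as `x → +∞`. -/
theorem statement12 (α : ℤ → ℝ) (hα : Summable fun j : ℤ => |(j : ℝ)| * |α j|)
    (lam : ℂ) (him : 0 ≤ lam.im) (hlam : lam ≠ 0) :
    (∀ x : ℝ,
      Summable (fun j : {j : ℤ // x < (j : ℝ)} =>
        (α j.1 : ℂ) * (Complex.exp (2 * Complex.I * lam * ((j.1 : ℂ) - (x : ℂ))) - 1) *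
          mPlus α lam (j.1 : ℝ)) ∧
      mPlus α lam x = 1 + (1 / (2 * Complex.I * lam)) *
        ∑' j : {j : ℤ // x < (j : ℝ)},
          (α j.1 : ℂ) * (Complex.exp (2 * Complex.I * lam * ((j.1 : ℂ) - (x : ℂ))) - 1) *
            mPlus α lam (j.1 : ℝ)) ∧
    Tendsto (fun x : ℝ => mPlus α lam x) atTop (nhds 1) := by
  have hα' := summable_abs_of_summable_abs_mul hα
  have hc : 2 * Complex.I * lam ≠ 0 := by simp [hlam]
  refine ⟨fun x => ?_, tendsto_mPlus_atTop hα' him⟩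
  have h := hasSum_jostStep_mul_mPlus hα' him x
  have h' : HasSum (fun j : {j : ℤ // x < (j : ℝ)} =>
      (α j.1 : ℂ) * (Complex.exp (2 * Complex.I * lam * ((j.1 : ℂ) - (x : ℂ))) - 1) *
        mPlus α lam (j.1 : ℝ)) (2 * Complex.I * lam * (mPlus α lam x - 1)) := by
    refine (h.mul_left (2 * Complex.I * lam)).congr_fun fun j => ?_
    unfold jostStep
    field_simp
  refine ⟨h'.summable, ?_⟩
  rw [h'.tsum_eq, ← mul_assoc, one_div_mul_cancel hc, one_mul, add_sub_cancel]
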